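/- Let Ubar ∈ ℝ^{N×n} have orthonormal columns and let F ∈ ℝ^{N×w} have rank n with all columns in the column span of Ubar. Let U ∈ ℝ^{N×n}, let P be an interpolation points matrix with PᵀU invertible and PᵀF of rank n, and set C = (PᵀU)^{-1}PᵀF and R = UC − F. Suppose the component-wise residuals r_i = ‖Rᵀe_i‖₂² satisfy r_{j(i)} ≤ c_1·exp(−c_2·i^a) for a bijection j of {1,…,N}, with c_1, c_2 > 0 and a > 1, and let S be the sampling points matrix selecting the indices j(1), …, j(m) (adaptive sampling), with complementary matrix Sbreve. Suppose ΔU ∈ ℝ^{N×n} satisfies SbreveᵀΔU = 0 and Sᵀ((U + ΔU)C − F) = 0 (a full-rank update), and suppose U + ΔU has rank n with orthonormal basis matrix Uhat of its column span. Then ‖Ubar − Uhat Uhatᵀ Ubar‖_F² ≤ c_3·exp(−c_2·m^a), where c_3 = c_1 / ((1 − exp(−c_2))·σ_min(F)²) and σ_min(F) is the smallest nonzero singular value of F. -/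

import Mathlib

open Matrix Finset

/-- Squared Frobenius norm of a real matrix. -/
noncomputable def frobSq {m k : ℕ} (A : Matrix (Fin m) (Fin k) ℝ) : ℝ :=
  ∑ i, ∑ j, A i j ^ 2

/-- Squared Euclidean norm of the `i`-th row of `A`, i.e. `‖Aᵀ e_i‖₂²`. -/
noncomputable def rowNormSq {m k : ℕ} (A : Matrix (Fin m) (Fin k) ℝ) (i : Fin m) : ℝ :=
  ∑ j, A i j ^ 2

/-- The matrix `[e_{s 0}, …, e_{s (m-1)}] ∈ ℝ^{N×m}` whose columns are the canonical
unit vectors of `ℝ^N` selected by `s`. -/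
noncomputable def samplingMatrix {N m : ℕ} (s : Fin m → Fin N) : Matrix (Fin N) (Fin m) ℝ :=
  Matrix.of fun i k => if i = s k then 1 else 0

/-- `σ : Fin r → ℝ` is the (decreasingly sorted) list of nonzero singular values of `M`. -/
def IsSingularValues {m k : ℕ} (M : Matrix (Fin m) (Fin k) ℝ) (r : ℕ) (σ : Fin r → ℝ) : Prop :=
  (∀ i, 0 < σ i) ∧ Antitone σ ∧
  ∃ (u : Fin r → Fin m → ℝ) (v : Fin r → Fin k → ℝ),
    (∀ i j, u i ⬝ᵥ u j = if i = j then (1 : ℝ) else 0) ∧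
    (∀ i j, v i ⬝ᵥ v j = if i = j then (1 : ℝ) else 0) ∧
    M = ∑ i, σ i • Matrix.vecMulVec (u i) (v i)

theorem frobSq_eq_trace {m k : ℕ} (A : Matrix (Fin m) (Fin k) ℝ) :
    frobSq A = (Aᵀ * A).trace := by
  simp only [frobSq, Matrix.trace, Matrix.diag, Matrix.mul_apply, Matrix.transpose_apply, ← sq]
  exact Finset.sum_comm

theorem frobSq_nonneg {m k : ℕ} (A : Matrix (Fin m) (Fin k) ℝ) : 0 ≤ frobSq A :=
  Finset.sum_nonneg fun _ _ => Finset.sum_nonneg fun _ _ => sq_nonneg _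

theorem frobSq_transpose {m k : ℕ} (A : Matrix (Fin m) (Fin k) ℝ) : frobSq Aᵀ = frobSq A :=
  Finset.sum_comm

theorem frobSq_sub_proj {N n k : ℕ} {Q : Matrix (Fin N) (Fin n) ℝ} (hQ : Qᵀ * Q = 1)
    (A : Matrix (Fin N) (Fin k) ℝ) :
    frobSq (A - Q * Qᵀ * A) = frobSq A - frobSq (Qᵀ * A) := by
  have h : (A - Q * Qᵀ * A)ᵀ * (A - Q * Qᵀ * A) = Aᵀ * A - (Qᵀ * A)ᵀ * (Qᵀ * A) := by
    have h' : Aᵀ * (Q * (Qᵀ * (Q * (Qᵀ * A)))) = Aᵀ * (Q * (Qᵀ * A)) := by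
      rw [← Matrix.mul_assoc Qᵀ Q, hQ, Matrix.one_mul]
    simp only [Matrix.transpose_sub, Matrix.transpose_mul, Matrix.transpose_transpose,
      Matrix.sub_mul, Matrix.mul_sub, Matrix.mul_assoc, h']
    abel
  rw [frobSq_eq_trace, frobSq_eq_trace, frobSq_eq_trace, h, Matrix.trace_sub]

theorem frobSq_sub_proj_le {N n k : ℕ} {Q : Matrix (Fin N) (Fin n) ℝ} (hQ : Qᵀ * Q = 1)
    (A : Matrix (Fin N) (Fin k) ℝ) : frobSq (A - Q * Qᵀ * A) ≤ frobSq A := by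
  rw [frobSq_sub_proj hQ]
  linarith [frobSq_nonneg (Qᵀ * A)]

theorem frobSq_mul_le {N n k : ℕ} {V : Matrix (Fin k) (Fin n) ℝ} (hV : Vᵀ * V = 1)
    (A : Matrix (Fin N) (Fin k) ℝ) : frobSq (A * V) ≤ frobSq A := by
  have h := frobSq_nonneg (Aᵀ - V * Vᵀ * Aᵀ)
  rw [frobSq_sub_proj hV, ← Matrix.transpose_mul, frobSq_transpose, frobSq_transpose] at h
  linarith

theorem frobSq_mul_orthogonal {N n : ℕ} {O : Matrix (Fin n) (Fin n) ℝ} (hO : Oᵀ * O = 1)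
    (A : Matrix (Fin N) (Fin n) ℝ) : frobSq (A * O) = frobSq A := by
  refine le_antisymm (frobSq_mul_le hO A) ?_
  have hO' : O * Oᵀ = 1 := mul_eq_one_comm.mp hO
  simpa [Matrix.mul_assoc, hO'] using frobSq_mul_le (V := Oᵀ) (by simpa using hO') (A * O)

theorem mul_frobSq_le_frobSq_mul_diagonal {N n : ℕ} (A : Matrix (Fin N) (Fin n) ℝ)
    {d : Fin n → ℝ} {c : ℝ} (hc : 0 ≤ c) (hd : ∀ i, c ≤ d i) :
    c ^ 2 * frobSq A ≤ frobSq (A * Matrix.diagonal d) := by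
  simp only [frobSq, Finset.mul_sum, Matrix.mul_diagonal, mul_pow]
  refine Finset.sum_le_sum fun i _ => Finset.sum_le_sum fun k _ => ?_
  have := pow_le_pow_left₀ hc (hd k) 2
  nlinarith [mul_le_mul_of_nonneg_left this (sq_nonneg (A i k))]

theorem IsSingularValues.exists_factorization {m k r : ℕ} {M : Matrix (Fin m) (Fin k) ℝ}
    {σ : Fin r → ℝ} (h : IsSingularValues M r σ) :
    ∃ (W : Matrix (Fin m) (Fin r) ℝ) (V : Matrix (Fin k) (Fin r) ℝ),
      Wᵀ * W = 1 ∧ Vᵀ * V = 1 ∧ M * V = W * Matrix.diagonal σ := by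
  obtain ⟨-, -, u, v, hu, hv, hM⟩ := h
  have hV : (Matrix.of v) * (Matrix.of v)ᵀ = 1 := by
    ext i j
    simpa [Matrix.mul_apply, dotProduct, Matrix.one_apply] using hv i j
  refine ⟨(Matrix.of u)ᵀ, (Matrix.of v)ᵀ, ?_, by simpa using hV, ?_⟩
  · ext i j
    simpa [Matrix.mul_apply, dotProduct, Matrix.one_apply] using hu i j
  · have hM' : M = (Matrix.of u)ᵀ * Matrix.diagonal σ * Matrix.of v := by
      rw [hM]
      ext a b
      rw [Matrix.sum_apply, Matrix.mul_apply]
      refine Finset.sum_congr rfl fun i _ => ?_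
      simp [Matrix.vecMulVec_apply, Matrix.mul_diagonal]
      ring
    rw [hM', Matrix.mul_assoc, hV, Matrix.mul_one]

/-- The projection error of the column space of `M` is controlled by the projection error of `M`
divided by the smallest singular value. -/
theorem IsSingularValues.mul_frobSq_sub_proj_le {N n w l : ℕ} {M : Matrix (Fin N) (Fin w) ℝ}
    {σ : Fin n → ℝ} (hσ : IsSingularValues M n σ) {B : Matrix (Fin N) (Fin n) ℝ}
    (hB : Bᵀ * B = 1) (hM : ∃ G : Matrix (Fin n) (Fin w) ℝ, M = B * G)
    (Q : Matrix (Fin N) (Fin l) ℝ) {c : ℝ} (hc : 0 ≤ c) (hcσ : ∀ i, c ≤ σ i) :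
    c ^ 2 * frobSq (B - Q * Qᵀ * B) ≤ frobSq (M - Q * Qᵀ * M) := by
  obtain ⟨W, V, hW, hV, hMV⟩ := hσ.exists_factorization
  obtain ⟨G, rfl⟩ := hM
  have hdiag : Matrix.diagonal σ * Matrix.diagonal (fun i => (σ i)⁻¹) = 1 := by
    rw [Matrix.diagonal_mul_diagonal, ← Matrix.diagonal_one]
    congr 1
    ext i
    exact mul_inv_cancel₀ (hσ.1 i).ne'
  obtain ⟨O, rfl⟩ : ∃ O : Matrix (Fin n) (Fin n) ℝ, W = B * O := by
    refine ⟨G * V * Matrix.diagonal (fun i => (σ i)⁻¹), ?_⟩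
    rw [← Matrix.mul_assoc, ← Matrix.mul_assoc, hMV, Matrix.mul_assoc, hdiag, Matrix.mul_one]
  have hO : Oᵀ * O = 1 := by
    rw [← hW, Matrix.transpose_mul, Matrix.mul_assoc, ← Matrix.mul_assoc Bᵀ, hB, Matrix.one_mul]
  calc c ^ 2 * frobSq (B - Q * Qᵀ * B)
      = c ^ 2 * frobSq ((B - Q * Qᵀ * B) * O) := by rw [frobSq_mul_orthogonal hO]
    _ ≤ frobSq ((B - Q * Qᵀ * B) * O * Matrix.diagonal σ) :=
        mul_frobSq_le_frobSq_mul_diagonal _ hc hcσ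
    _ = frobSq ((B * G - Q * Qᵀ * (B * G)) * V) := by
        simp only [Matrix.sub_mul, Matrix.mul_assoc] at hMV ⊢
        rw [hMV]
    _ ≤ frobSq (B * G - Q * Qᵀ * (B * G)) := frobSq_mul_le hV _

theorem samplingMatrix_transpose_mul_apply {N m k : ℕ} (s : Fin m → Fin N)
    (A : Matrix (Fin N) (Fin k) ℝ) (i : Fin m) (l : Fin k) :
    ((samplingMatrix s)ᵀ * A) i l = A (s i) l := by
  simp [samplingMatrix, Matrix.mul_apply]

theorem exp_neg_mul_rpow_add_le {c a : ℝ} (hc : 0 < c) (ha : 1 ≤ a) (m k : ℕ) :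
    Real.exp (-c * ((m + k + 1 : ℕ) : ℝ) ^ a) ≤
      Real.exp (-c * (m : ℝ) ^ a) * Real.exp (-c) ^ k := by
  rw [← Real.exp_nat_mul, ← Real.exp_add, Real.exp_le_exp]
  have h₁ : (m : ℝ) ^ a + ((k : ℝ) + 1) ^ a ≤ ((m : ℝ) + (k + 1)) ^ a :=
    Real.add_rpow_le_rpow_add m.cast_nonneg (by positivity) ha
  have h₂ : (k : ℝ) + 1 ≤ ((k : ℝ) + 1) ^ a :=
    Real.self_le_rpow_of_one_le (by linarith [k.cast_nonneg (α := ℝ)]) ha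
  have h₃ : ((m + k + 1 : ℕ) : ℝ) = (m : ℝ) + (k + 1) := by push_cast; ring
  rw [h₃]
  nlinarith

theorem sum_tail_exp_neg_mul_rpow_le {c a : ℝ} (hc : 0 < c) (ha : 1 ≤ a) (m N : ℕ) :
    ∑ i ∈ Finset.Ico m N, Real.exp (-c * ((i + 1 : ℕ) : ℝ) ^ a) ≤
      Real.exp (-c * (m : ℝ) ^ a) / (1 - Real.exp (-c)) := by
  have hq : Real.exp (-c) < 1 := by simpa using hc
  rw [Finset.sum_Ico_eq_sum_range]
  calc ∑ k ∈ Finset.range (N - m), Real.exp (-c * ((m + k + 1 : ℕ) : ℝ) ^ a)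
      ≤ ∑ k ∈ Finset.range (N - m), Real.exp (-c * (m : ℝ) ^ a) * Real.exp (-c) ^ k :=
        Finset.sum_le_sum fun k _ => exp_neg_mul_rpow_add_le hc ha m k
    _ = Real.exp (-c * (m : ℝ) ^ a) * ∑ k ∈ Finset.range (N - m), Real.exp (-c) ^ k := by
        rw [Finset.mul_sum]
    _ ≤ Real.exp (-c * (m : ℝ) ^ a) * (1 - Real.exp (-c))⁻¹ := by
        rw [← tsum_geometric_of_lt_one (Real.exp_pos _).le hq]
        gcongr
        exact (summable_geometric_of_lt_one (Real.exp_pos _).le hq).sum_le_tsum _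
          fun _ _ => by positivity
    _ = _ := by rw [div_eq_mul_inv]

/-- If the rows `j 0, …, j (m - 1)` of `A` vanish and the others decay exponentially, then so
does the squared Frobenius norm of `A`. -/
theorem frobSq_le_of_row_decay {N w m : ℕ} (A : Matrix (Fin N) (Fin w) ℝ)
    (j : Equiv.Perm (Fin N)) {b c a : ℝ} (hb : 0 ≤ b) (hc : 0 < c) (ha : 1 ≤ a)
    (hzero : ∀ i : Fin N, (i : ℕ) < m → rowNormSq A (j i) = 0)
    (hdecay : ∀ i : Fin N, m ≤ (i : ℕ) →
      rowNormSq A (j i) ≤ b * Real.exp (-c * (((i : ℕ) + 1 : ℕ) : ℝ) ^ a)) :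
    frobSq A ≤ b * (Real.exp (-c * (m : ℝ) ^ a) / (1 - Real.exp (-c))) := by
  let f : ℕ → ℝ := fun i => if m ≤ i then b * Real.exp (-c * ((i + 1 : ℕ) : ℝ) ^ a) else 0
  calc frobSq A = ∑ i, rowNormSq A (j i) := (Equiv.sum_comp j (rowNormSq A)).symm
    _ ≤ ∑ i : Fin N, f i := by
        refine Finset.sum_le_sum fun i _ => ?_
        by_cases h : m ≤ (i : ℕ)
        · simpa only [f, if_pos h] using hdecay i h
        · simpa only [f, if_neg h] using (hzero i (not_le.mp h)).le
    _ = ∑ i ∈ Finset.range N, f i := Fin.sum_univ_eq_sum_range f N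
    _ = b * ∑ i ∈ Finset.Ico m N, Real.exp (-c * ((i + 1 : ℕ) : ℝ) ^ a) := by
        rw [Finset.mul_sum, ← Finset.sum_filter]
        refine Finset.sum_congr ?_ fun _ _ => rfl
        ext i
        simp [and_comm]
    _ ≤ _ := mul_le_mul_of_nonneg_left (sum_tail_exp_neg_mul_rpow_le hc ha m N) hb

/-- (Proposition 3.3.)  If the component-wise residuals `‖Rᵀe_{j(i)}‖₂²` decay
exponentially along a bijection `j`, the sampling points matrix `S` selects the indices
`j(1), …, j(m)` (adaptive sampling), and a full-rank update `ΔU` supported on the sampled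
rows makes the sampled residual vanish, then the adapted space with orthonormal basis
`Uhat` (spanning the column span of `U + ΔU`) satisfies
`‖Ubar − Uhat Uhatᵀ Ubar‖_F² ≤ c₃ exp(−c₂ m^a)` with
`c₃ = c₁ / ((1 − exp(−c₂))·σ_min(F)²)`. -/
theorem adaptive_sampling_adapted_space_error_bound
    {N n w m : ℕ} (hn : 0 < n) (hm : m ≤ N)
    (Ubar : Matrix (Fin N) (Fin n) ℝ) (hUbar : Ubarᵀ * Ubar = 1)
    (F : Matrix (Fin N) (Fin w) ℝ)
    (hFspan : ∃ G : Matrix (Fin n) (Fin w) ℝ, F = Ubar * G)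
    (σF : Fin n → ℝ) (hσF : IsSingularValues F n σF)
    (U : Matrix (Fin N) (Fin n) ℝ)
    (p : Fin n → Fin N) (hp : Function.Injective p)
    (hPU : IsUnit ((samplingMatrix p)ᵀ * U))
    (hPF : ((samplingMatrix p)ᵀ * F).rank = n)
    (C : Matrix (Fin n) (Fin w) ℝ)
    (hC : C = ((samplingMatrix p)ᵀ * U)⁻¹ * ((samplingMatrix p)ᵀ * F))
    (R : Matrix (Fin N) (Fin w) ℝ) (hR : R = U * C - F)
    (j : Equiv.Perm (Fin N)) (c₁ c₂ a : ℝ)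
    (hc₁ : 0 < c₁) (hc₂ : 0 < c₂) (ha : 1 < a)
    (hdecay : ∀ i : Fin N,
      rowNormSq R (j i) ≤ c₁ * Real.exp (-c₂ * (((i : ℕ) + 1 : ℕ) : ℝ) ^ a))
    (ΔU : Matrix (Fin N) (Fin n) ℝ)
    (h1 : (samplingMatrix fun k : Fin (N - m) =>
        j ⟨m + (k : ℕ), by have := k.isLt; omega⟩)ᵀ * ΔU = 0)
    (h2 : (samplingMatrix fun k : Fin m => j (Fin.castLE hm k))ᵀ *
        ((U + ΔU) * C - F) = 0)
    (Uhat : Matrix (Fin N) (Fin n) ℝ) (hUhat : Uhatᵀ * Uhat = 1)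
    (hspan : ∃ G : Matrix (Fin n) (Fin n) ℝ, IsUnit G ∧ U + ΔU = Uhat * G) :
    frobSq (Ubar - Uhat * Uhatᵀ * Ubar) ≤
      c₁ / ((1 - Real.exp (-c₂)) * σF ⟨n - 1, Nat.sub_lt hn one_pos⟩ ^ 2) *
        Real.exp (-c₂ * (m : ℝ) ^ a) := by
  set σ := σF ⟨n - 1, Nat.sub_lt hn one_pos⟩ with hσ
  have hσ_pos : 0 < σ := hσF.1 _
  have hσ_le : ∀ i, σ ≤ σF i := fun i => hσF.2.1 (Fin.mk_le_mk.mpr (by omega))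
  have hq : 0 < 1 - Real.exp (-c₂) := by simpa using hc₂
  obtain ⟨G, -, hG⟩ := hspan
  set E := F - (U + ΔU) * C with hE
  have hproj : F - Uhat * Uhatᵀ * F = E - Uhat * Uhatᵀ * E := by
    have h : Uhat * Uhatᵀ * ((U + ΔU) * C) = (U + ΔU) * C := by
      rw [hG]
      simp only [Matrix.mul_assoc]
      rw [← Matrix.mul_assoc Uhatᵀ, hUhat, Matrix.one_mul]
    rw [hE, Matrix.mul_sub, h]
    abel
  have hsampled : ∀ i : Fin N, (i : ℕ) < m → rowNormSq E (j i) = 0 := by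
    intro i hi
    refine Finset.sum_eq_zero fun l _ => ?_
    have h := congrFun (congrFun h2 ⟨i, hi⟩) l
    rw [samplingMatrix_transpose_mul_apply] at h
    simp only [Matrix.sub_apply, Matrix.zero_apply, Fin.castLE_mk, Fin.eta] at h
    rw [hE, Matrix.sub_apply]
    nlinarith
  have hunsampled : ∀ i : Fin N, m ≤ (i : ℕ) → rowNormSq E (j i) = rowNormSq R (j i) := by
    intro i hi
    have h : ∀ l, ΔU (j i) l = 0 := by
      intro l
      have h := congrFun (congrFun h1 ⟨i - m, by omega⟩) l
      rw [samplingMatrix_transpose_mul_apply] at h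
      simpa only [Nat.add_sub_cancel' hi, Fin.eta, Matrix.zero_apply] using h
    refine Finset.sum_congr rfl fun l _ => ?_
    have h' : (ΔU * C) (j i) l = 0 := by simp [Matrix.mul_apply, h]
    rw [hE, hR, Matrix.add_mul]
    simp only [Matrix.sub_apply, Matrix.add_apply, h']
    ring
  have hbound : σ ^ 2 * frobSq (Ubar - Uhat * Uhatᵀ * Ubar) ≤
      c₁ * (Real.exp (-c₂ * (m : ℝ) ^ a) / (1 - Real.exp (-c₂))) :=
    calc _ ≤ frobSq (F - Uhat * Uhatᵀ * F) :=
          hσF.mul_frobSq_sub_proj_le hUbar hFspan Uhat hσ_pos.le hσ_le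
      _ ≤ frobSq E := hproj ▸ frobSq_sub_proj_le hUhat E
      _ ≤ _ := frobSq_le_of_row_decay E j hc₁.le hc₂ ha.le hsampled fun i hi =>
          (hunsampled i hi).trans_le (hdecay i)
  calc frobSq (Ubar - Uhat * Uhatᵀ * Ubar)
      ≤ c₁ * (Real.exp (-c₂ * (m : ℝ) ^ a) / (1 - Real.exp (-c₂))) / σ ^ 2 := by
        rw [le_div_iff₀ (by positivity), mul_comm]
        exact hbound
    _ = _ := by field_simp
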